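/- Let K be a centrally symmetric convex domain (centered at the origin) without corners. Assume that for each point p on the boundary of K there exists a balanced hexagon G_p of K having p as one of its midpoints, and that the area of G_p does not depend on p. Then K has no balanced hexagons other than the hexagons G_p, and δ_lat(K) = area(K)/area(G) for every balanced hexagon G of K. -/

import Mathlib

open MeasureTheory

noncomputable section

/-- The wedge (cross) product of two planar vectors. -/
def wedge (v w : ℝ × ℝ) : ℝ := v.1 * w.2 - v.2 * w.1

/-- A centrally symmetric convex domain in the plane. -/
def IsCSCD (K : Set (ℝ × ℝ)) : Prop :=
  Convex ℝ K ∧ IsCompact K ∧ (interior K).Nonempty ∧ K = -K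

/-- The lattice spanned over `ℤ` by the vectors `v` and `w`. -/
def latticeOf (v w : ℝ × ℝ) : Set (ℝ × ℝ) :=
  {p | ∃ m n : ℤ, p = (m : ℝ) • v + (n : ℝ) • w}

/-- `Λ + K` is a packing of `K`. -/
def IsPacking (K Λ : Set (ℝ × ℝ)) : Prop :=
  ∀ p ∈ Λ, ∀ q ∈ Λ, p ≠ q →
    interior ((fun x => p + x) '' K) ∩ interior ((fun x => q + x) '' K) = ∅

/-- The set of densities of lattice packings of `K`. -/
def packingDensities (K : Set (ℝ × ℝ)) : Set ℝ :=
  {d | ∃ v w : ℝ × ℝ, wedge v w ≠ 0 ∧ IsPacking K (latticeOf v w) ∧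
       d = (volume K).toReal / |wedge v w|}

/-- `δ_lat(K)`: the supremum of densities of lattice packings of `K`. -/
def deltaLat (K : Set (ℝ × ℝ)) : ℝ := sSup (packingDensities K)

/-- `L` is a supporting line of `K` at the boundary point `p`. -/
def IsSupportingLineAt (K : Set (ℝ × ℝ)) (p : ℝ × ℝ) (L : Set (ℝ × ℝ)) : Prop :=
  ∃ f : (ℝ × ℝ) →ₗ[ℝ] ℝ, f ≠ 0 ∧ L = {x | f x = f p} ∧ ∀ x ∈ K, f x ≤ f p

/-- `K` has no corners. -/
def NoCorners (K : Set (ℝ × ℝ)) : Prop :=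
  ∀ p ∈ frontier K, ∃! L : Set (ℝ × ℝ), IsSupportingLineAt K p L

/-- `w : ZMod 6 → ℝ × ℝ` lists, in counterclockwise cyclic order, the vertices of
a balanced hexagon of `K`. -/
def IsBalancedHexagon (K : Set (ℝ × ℝ)) (w : ZMod 6 → ℝ × ℝ) : Prop :=
  (∀ j, w (j + 3) = -w j) ∧
  (∀ j, 0 ≤ wedge (w (j + 1) - w j) (w (j + 2) - w (j + 1))) ∧
  K ⊆ convexHull ℝ (Set.range w) ∧
  (∀ j, midpoint ℝ (w j) (w (j + 1)) ∈ frontier K)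

/-! ### The wedge product -/

lemma wedge_self (v : ℝ × ℝ) : wedge v v = 0 := by
  simp only [wedge]; ring

lemma wedge_swap (v w : ℝ × ℝ) : wedge v w = -wedge w v := by
  simp only [wedge]; ring

/-- The wedge product with a fixed vector on the left, as a linear functional. -/
def wedgeLeft (v : ℝ × ℝ) : (ℝ × ℝ) →ₗ[ℝ] ℝ where
  toFun := wedge v
  map_add' x y := by simp only [wedge, Prod.fst_add, Prod.snd_add]; ring
  map_smul' c x := by
    simp only [wedge, Prod.smul_fst, Prod.smul_snd, smul_eq_mul, RingHom.id_apply]; ring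

@[simp] lemma wedgeLeft_apply (v x : ℝ × ℝ) : wedgeLeft v x = wedge v x := rfl

lemma wedge_add_right (v x y : ℝ × ℝ) : wedge v (x + y) = wedge v x + wedge v y :=
  (wedgeLeft v).map_add x y

lemma wedge_sub_right (v x y : ℝ × ℝ) : wedge v (x - y) = wedge v x - wedge v y :=
  (wedgeLeft v).map_sub x y

lemma wedge_neg_right (v x : ℝ × ℝ) : wedge v (-x) = -wedge v x :=
  (wedgeLeft v).map_neg x

lemma wedge_smul_right (c : ℝ) (v x : ℝ × ℝ) : wedge v (c • x) = c * wedge v x :=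
  (wedgeLeft v).map_smul c x

lemma wedge_add_left (v w x : ℝ × ℝ) : wedge (v + w) x = wedge v x + wedge w x := by
  rw [wedge_swap, wedge_add_right, wedge_swap x v, wedge_swap x w]; ring

lemma wedge_sub_left (v w x : ℝ × ℝ) : wedge (v - w) x = wedge v x - wedge w x := by
  rw [wedge_swap, wedge_sub_right, wedge_swap x v, wedge_swap x w]; ring

lemma wedge_neg_left (v x : ℝ × ℝ) : wedge (-v) x = -wedge v x := by
  rw [wedge_swap, wedge_neg_right, wedge_swap x v, neg_neg]

lemma wedge_smul_left (c : ℝ) (v x : ℝ × ℝ) : wedge (c • v) x = c * wedge v x := by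
  rw [wedge_swap, wedge_smul_right, wedge_swap x v]; ring

/-- Cramer's rule in the plane. -/
lemma wedge_smul_eq (v w x : ℝ × ℝ) :
    wedge v w • x = wedge x w • v + wedge v x • w := by
  ext <;> simp only [wedge, Prod.smul_fst, Prod.smul_snd, Prod.fst_add, Prod.snd_add,
    smul_eq_mul] <;> ring

lemma eq_zero_of_wedge_eq_zero {v w x : ℝ × ℝ} (h : wedge v w ≠ 0) (hv : wedge v x = 0)
    (hw : wedge w x = 0) : x = 0 := by
  have := wedge_smul_eq v w x
  rw [hv, wedge_swap x w, hw] at this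
  simpa [h] using this

lemma exists_smul_of_wedge_eq_zero {u x : ℝ × ℝ} (hu : u ≠ 0) (h : wedge u x = 0) :
    ∃ t : ℝ, x = t • u := by
  have hs : 0 < u.1 ^ 2 + u.2 ^ 2 := by
    by_contra hle
    apply hu
    ext
    · exact pow_eq_zero_iff two_ne_zero |>.1 (by nlinarith [sq_nonneg u.1, sq_nonneg u.2])
    · exact pow_eq_zero_iff two_ne_zero |>.1 (by nlinarith [sq_nonneg u.1, sq_nonneg u.2])
  simp only [wedge] at h
  refine ⟨(u.1 * x.1 + u.2 * x.2) / (u.1 ^ 2 + u.2 ^ 2), ?_⟩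
  ext
  · simp only [Prod.smul_fst, smul_eq_mul]
    field_simp
    linear_combination (-u.2) * h
  · simp only [Prod.smul_snd, smul_eq_mul]
    field_simp
    linear_combination u.1 * h

lemma wedge_self_perp_pos {u : ℝ × ℝ} (hu : u ≠ 0) : 0 < wedge u (-u.2, u.1) := by
  by_contra hle
  simp only [wedge] at hle
  apply hu
  ext
  · exact pow_eq_zero_iff two_ne_zero |>.1 (by nlinarith [sq_nonneg u.1, sq_nonneg u.2])
  · exact pow_eq_zero_iff two_ne_zero |>.1 (by nlinarith [sq_nonneg u.1, sq_nonneg u.2])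

/-! ### Centrally symmetric convex domains and supporting functionals -/

namespace IsCSCD

variable {K : Set (ℝ × ℝ)}

lemma neg_mem (hK : IsCSCD K) {x : ℝ × ℝ} (hx : x ∈ K) : -x ∈ K := by
  have h := hK.2.2.2
  rw [h] at hx
  exact hx

lemma neg_mem_interior (hK : IsCSCD K) {x : ℝ × ℝ} (hx : x ∈ interior K) :
    -x ∈ interior K := by
  have h : interior K = -interior K := by
    conv_lhs => rw [hK.2.2.2]
    exact ((Homeomorph.neg (ℝ × ℝ)).preimage_interior K).symm
  rw [h] at hx
  exact hx

lemma zero_mem_interior (hK : IsCSCD K) : (0 : ℝ × ℝ) ∈ interior K := by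
  obtain ⟨x, hx⟩ := hK.2.2.1
  have := hK.1.interior hx (hK.neg_mem_interior hx) (a := 1 / 2) (b := 1 / 2)
    (by norm_num) (by norm_num) (by norm_num)
  simpa using this

lemma mem_nhds_zero (hK : IsCSCD K) : K ∈ nhds (0 : ℝ × ℝ) :=
  mem_interior_iff_mem_nhds.1 hK.zero_mem_interior

lemma frontier_subset (hK : IsCSCD K) : frontier K ⊆ K :=
  hK.2.1.isClosed.frontier_subset

lemma ne_zero_of_mem_frontier (hK : IsCSCD K) {p : ℝ × ℝ} (hp : p ∈ frontier K) : p ≠ 0 := by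
  rintro rfl
  exact hp.2 hK.zero_mem_interior

lemma exists_pos_smul_mem (hK : IsCSCD K) (v : ℝ × ℝ) : ∃ c : ℝ, 0 < c ∧ c • v ∈ K := by
  have h : Filter.Tendsto (fun c : ℝ => c • v) (nhds 0) (nhds (0 : ℝ × ℝ)) := by
    have : Continuous fun c : ℝ => c • v := by fun_prop
    simpa using this.tendsto 0
  have h1 := (h.eventually hK.mem_nhds_zero).filter_mono (nhdsWithin_le_nhds (s := Set.Ioi 0))
  obtain ⟨c, hc, hc0⟩ := (h1.and self_mem_nhdsWithin).exists
  exact ⟨c, hc0, hc⟩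

lemma eq_zero_of_nonneg (hK : IsCSCD K) {f : (ℝ × ℝ) →ₗ[ℝ] ℝ} (hf : ∀ x ∈ K, 0 ≤ f x) :
    f = 0 := by
  refine LinearMap.ext fun v => ?_
  obtain ⟨c, hc, hm⟩ := hK.exists_pos_smul_mem v
  have h1 := hf _ hm
  have h2 := hf _ (hK.neg_mem hm)
  rw [map_neg, map_smul, smul_eq_mul] at h2
  rw [map_smul, smul_eq_mul] at h1
  have : c * f v = 0 := le_antisymm (by linarith) h1
  exact (mul_eq_zero.1 this).resolve_left hc.ne'

lemma exists_wedge_neg (hK : IsCSCD K) {v : ℝ × ℝ} (hv : v ≠ 0) : ∃ x ∈ K, wedge v x < 0 := by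
  by_contra! h
  have h0 := hK.eq_zero_of_nonneg (f := wedgeLeft v) h
  have := wedge_self_perp_pos hv
  rw [← wedgeLeft_apply, h0] at this
  simp at this

end IsCSCD

/-- The linear functionals that are at most `1` on `K` and equal to `1` at `p`. -/
def normals (K : Set (ℝ × ℝ)) (p : ℝ × ℝ) : Set ((ℝ × ℝ) →ₗ[ℝ] ℝ) :=
  {f | f p = 1 ∧ ∀ y ∈ K, f y ≤ 1}

lemma normals_subsingleton {K : Set (ℝ × ℝ)} (hnc : NoCorners K) {p : ℝ × ℝ}
    (hp : p ∈ frontier K) {f g : (ℝ × ℝ) →ₗ[ℝ] ℝ} (hf : f ∈ normals K p)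
    (hg : g ∈ normals K p) : f = g := by
  have key : ∀ f ∈ normals K p, IsSupportingLineAt K p {x | f x = f p} := fun f hf =>
    ⟨f, fun h => by simpa [h] using hf.1, rfl, fun x hx => hf.1.symm ▸ hf.2 x hx⟩
  have hline := (hnc p hp).unique (key f hf) (key g hg)
  rw [hf.1, hg.1] at hline
  have hfg : ∀ x, f x = 1 → g x = 1 := fun x hx => by
    have : x ∈ {x | f x = 1} := hx
    rwa [hline] at this
  refine LinearMap.ext fun x => ?_
  have shift : ∀ x, f x ≠ 0 → f x = g x := fun x hx => by
    have := hfg ((f x)⁻¹ • x) (by simp [hx])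
    rw [map_smul, smul_eq_mul, inv_mul_eq_one₀ hx] at this
    exact this
  by_cases hx : f x = 0
  · have := hfg (x + p) (by rw [map_add, hx, hf.1, zero_add])
    rw [map_add, hg.1] at this
    linarith
  · exact shift x hx

lemma neg_mem_normals {K : Set (ℝ × ℝ)} (hK : IsCSCD K) {p : ℝ × ℝ}
    {f : (ℝ × ℝ) →ₗ[ℝ] ℝ} (hf : f ∈ normals K p) : -f ∈ normals K (-p) := by
  refine ⟨by simp [hf.1], fun y hy => ?_⟩
  have := hf.2 _ (hK.neg_mem hy)
  rwa [map_neg] at this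

lemma abs_le_one_of_mem_normals {K : Set (ℝ × ℝ)} (hK : IsCSCD K) {p : ℝ × ℝ}
    {f : (ℝ × ℝ) →ₗ[ℝ] ℝ} (hf : f ∈ normals K p) {y : ℝ × ℝ} (hy : y ∈ K) : |f y| ≤ 1 := by
  have := hf.2 _ (hK.neg_mem hy)
  rw [map_neg] at this
  exact abs_le.2 ⟨by linarith, hf.2 y hy⟩

lemma abs_lt_one_of_mem_normals {K : Set (ℝ × ℝ)} (hK : IsCSCD K) {p : ℝ × ℝ}
    {f : (ℝ × ℝ) →ₗ[ℝ] ℝ} (hf : f ∈ normals K p) {y : ℝ × ℝ} (hy : y ∈ interior K) :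
    |f y| < 1 := by
  have h : Filter.Tendsto (fun c : ℝ => c • y) (nhds 1) (nhds y) := by
    have : Continuous fun c : ℝ => c • y := by fun_prop
    simpa using this.tendsto 1
  have h1 := (h.eventually (mem_interior_iff_mem_nhds.1 hy)).filter_mono
    (nhdsWithin_le_nhds (s := Set.Ioi 1))
  obtain ⟨c, hc, hc1⟩ := (h1.and self_mem_nhdsWithin).exists
  have hc1 : 1 < c := hc1
  have := abs_le_one_of_mem_normals hK hf hc
  rw [map_smul, smul_eq_mul, abs_mul, abs_of_pos (by linarith)] at this
  nlinarith [abs_nonneg (f y)]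

/-- Chords of `K` parallel to `u` that have length `u` and end on the boundary lie at least as
high as any other chord of that length. -/
lemma wedge_le_of_normals {K : Set (ℝ × ℝ)} {u v y : ℝ × ℝ}
    {f g : (ℝ × ℝ) →ₗ[ℝ] ℝ} (hu0 : u ≠ 0) (hu : u ∈ K) (hv : v ∈ K) (hvu : v - u ∈ K)
    (hy : y ∈ K) (hyu : y - u ∈ K) (hf : f ∈ normals K v) (hg : g ∈ normals K (v - u))
    (h0 : 0 ≤ wedge u v) : wedge u y ≤ wedge u v := by
  by_contra! hlt
  have hy0 : 0 < wedge u y := h0.trans_lt hlt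
  set l := wedge u v / wedge u y with hl
  have hl0 : 0 ≤ l := by positivity
  have hl1 : l < 1 := (div_lt_one hy0).2 hlt
  obtain ⟨s, hs⟩ := exists_smul_of_wedge_eq_zero (x := v - l • y) hu0 (by
    rw [wedge_sub_right, wedge_smul_right, hl]; field_simp; ring)
  have hv' : v = l • y + s • u := by rw [← hs]; abel
  have f1 : l * f y + s * f u = 1 := by
    have := hf.1
    rw [hv'] at this
    simpa using this
  have g1 : l * g y + s * g u - g u = 1 := by
    have := hg.1
    rw [hv'] at this
    simpa using this
  have f2 := hf.2 _ hvu
  have g2 := hg.2 _ hv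
  have f3 := hf.2 _ hy
  have g3 := hg.2 _ hyu
  have f4 := hf.2 _ hu
  have f5 := hf.1
  have g5 := hg.1
  rw [map_sub] at f2 g3 g5
  have hfu : 0 < f u := by
    rcases (show 0 ≤ f u by linarith).eq_or_lt with h | h
    · rw [← h] at f1; nlinarith
    · exact h
  have hgu : g u ≤ 0 := by linarith
  have hs : 0 ≤ s - 1 + l := by
    by_contra! hneg
    have : s * f u < 1 - l ∨ s * f u ≤ 0 := by
      rcases le_or_gt s 0 with h | h
      · right; nlinarith
      · left; nlinarith
    rcases this with h | h <;> nlinarith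
  nlinarith [mul_nonneg hs (neg_nonneg.2 hgu)]

/-! ### Balanced hexagons -/

lemma zmod_six_add_eq (j : ZMod 6) :
    j + 1 + 1 = j + 2 ∧ j + 1 + 2 = j + 3 ∧ j + 2 + 1 = j + 3 ∧ j + 2 + 2 = j + 4 := by
  refine ⟨?_, ?_, ?_, ?_⟩ <;> ring

/-- The midpoint of the `j`-th side of a hexagon. -/
def sideMid (w : ZMod 6 → ℝ × ℝ) (j : ZMod 6) : ℝ × ℝ := midpoint ℝ (w j) (w (j + 1))

lemma sideMid_eq (w : ZMod 6 → ℝ × ℝ) (j : ZMod 6) :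
    sideMid w j = (1 / 2 : ℝ) • (w j + w (j + 1)) := by
  rw [sideMid, midpoint_eq_smul_add, invOf_eq_inv, one_div]

lemma forall_zmod_six {P : ZMod 6 → Prop} (j : ZMod 6) (h0 : P j) (h1 : P (j + 1))
    (h2 : P (j + 2)) (h3 : P (j + 3)) (h4 : P (j + 4)) (h5 : P (j + 5)) (i : ZMod 6) : P i := by
  obtain ⟨k, rfl⟩ : ∃ k, i = j + k := ⟨i - j, by ring⟩
  fin_cases k
  · change P (j + 0)
    rwa [add_zero]
  · exact h1
  · exact h2
  · exact h3
  · exact h4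
  · exact h5

lemma exists_nonneg_neg {σ : ZMod 6 → ℝ} (hσ : ∀ j, σ (j + 3) = -σ j) {i : ZMod 6}
    (hi : σ i ≠ 0) : ∃ j, 0 ≤ σ j ∧ σ (j + 1) < 0 := by
  by_contra! h
  have key : ∀ j, 0 ≤ σ j → σ j = 0 := fun j hj => by
    obtain ⟨a1, a2, -, -⟩ := zmod_six_add_eq j
    have h1 := h j hj
    have h2 := h _ h1
    rw [a1] at h2
    have h3 := h _ h2
    rw [(zmod_six_add_eq j).2.2.1, hσ] at h3
    linarith
  rcases le_total 0 (σ i) with h0 | h0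
  · exact hi (key i h0)
  · have := key (i + 3) (by rw [hσ]; linarith)
    rw [hσ] at this
    exact hi (by linarith)

namespace IsBalancedHexagon

variable {K : Set (ℝ × ℝ)} {w : ZMod 6 → ℝ × ℝ}

lemma shift (hw : IsBalancedHexagon K w) (k : ZMod 6) :
    IsBalancedHexagon K (fun j => w (j + k)) ∧
      Set.range (fun j => w (j + k)) = Set.range w := by
  have hr : Set.range (fun j => w (j + k)) = Set.range w :=
    (Equiv.addRight k).surjective.range_comp w
  obtain ⟨h1, h2, h3, h4⟩ := hw
  refine ⟨⟨fun j => ?_, fun j => ?_, hr.symm ▸ h3, fun j => ?_⟩, hr⟩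
  · simpa only [add_right_comm] using h1 (j + k)
  · simpa only [add_right_comm] using h2 (j + k)
  · simpa only [add_right_comm] using h4 (j + k)

lemma apply_add_four (hw : IsBalancedHexagon K w) (j : ZMod 6) : w (j + 4) = -w (j + 1) := by
  rw [← hw.1]; congr 1; ring

lemma apply_add_five (hw : IsBalancedHexagon K w) (j : ZMod 6) : w (j + 5) = -w (j + 2) := by
  rw [← hw.1]; congr 1; ring

lemma sideMid_add_three (hw : IsBalancedHexagon K w) (j : ZMod 6) :
    sideMid w (j + 3) = -sideMid w j := by
  rw [sideMid_eq, sideMid_eq, hw.1, add_right_comm, hw.1]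
  module

lemma sideMid_add_two (hw : IsBalancedHexagon K w) (j : ZMod 6) :
    sideMid w (j + 2) = sideMid w (j + 1) - sideMid w j := by
  obtain ⟨a1, -, a3, -⟩ := zmod_six_add_eq j
  rw [sideMid_eq, sideMid_eq, sideMid_eq, a1, a3, hw.1]
  module

lemma sideMid_mem_frontier (hw : IsBalancedHexagon K w) (j : ZMod 6) :
    sideMid w j ∈ frontier K := hw.2.2.2 j

lemma wedge_side_vertex (hw : IsBalancedHexagon K w) (j i : ZMod 6) :
    -wedge (w j) (w (j + 1)) ≤ wedge (w (j + 1) - w j) (w i) := by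
  obtain ⟨a1, a2, a3, a4⟩ := zmod_six_add_eq j
  have t0 := hw.2.1 j
  have t1 := hw.2.1 (j + 1)
  have t2 := hw.2.1 (j + 2)
  rw [a1, a2, hw.1] at t1
  rw [a3, a4, hw.1, hw.apply_add_four] at t2
  induction i using forall_zmod_six j
  all_goals
    try rw [hw.1]
    try rw [hw.apply_add_four]
    try rw [hw.apply_add_five]
    simp only [wedge, Prod.fst_sub, Prod.snd_sub, Prod.fst_neg, Prod.snd_neg] at *
    linarith

lemma wedge_side (hw : IsBalancedHexagon K w) (j : ZMod 6) {x : ℝ × ℝ}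
    (hx : x ∈ convexHull ℝ (Set.range w)) :
    -wedge (w j) (w (j + 1)) ≤ wedge (w (j + 1) - w j) x := by
  have hc : Convex ℝ {x | -wedge (w j) (w (j + 1)) ≤ wedgeLeft (w (j + 1) - w j) x} :=
    convex_halfSpace_ge (wedgeLeft _).isLinear _
  refine convexHull_min ?_ hc hx
  rintro _ ⟨i, rfl⟩
  exact hw.wedge_side_vertex j i

lemma not_collinear (hw : IsBalancedHexagon K w) (hK : IsCSCD K) {v : ℝ × ℝ} (hv : v ≠ 0) :
    ∃ i, wedge v (w i) ≠ 0 := by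
  by_contra! h
  obtain ⟨x, hx, hneg⟩ := hK.exists_wedge_neg hv
  have hc : Convex ℝ {x | 0 ≤ wedgeLeft v x} := convex_halfSpace_ge (wedgeLeft _).isLinear _
  have : K ⊆ {x | 0 ≤ wedgeLeft v x} := hw.2.2.1.trans (convexHull_min (by
    rintro _ ⟨i, rfl⟩
    exact (h i).ge) hc)
  exact hneg.not_ge (this hx)

lemma side_ne_zero (hw : IsBalancedHexagon K w) (hK : IsCSCD K) (hnc : NoCorners K)
    (j : ZMod 6) : w (j + 1) - w j ≠ 0 := by
  intro he
  obtain ⟨a1, a2, a3, a4⟩ := zmod_six_add_eq j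
  have heq : w (j + 1) = w j := sub_eq_zero.1 he
  have hp : w j ∈ frontier K := by
    have := hw.2.2.2 j
    rwa [heq, midpoint_self] at this
  have hp0 := hK.ne_zero_of_mem_frontier hp
  have hpq : wedge (w j) (w (j + 2)) ≠ 0 := by
    intro h
    obtain ⟨i, hi⟩ := hw.not_collinear hK hp0
    apply hi
    induction i using forall_zmod_six j
    all_goals
      try rw [hw.1]
      try rw [hw.apply_add_four]
      try rw [hw.apply_add_five]
      simp [heq, wedge_neg_right, wedge_self, h]
  have h1 : ∀ x ∈ K, -wedge (w j) (w (j + 2)) ≤ wedge (w (j + 2) - w j) x := fun x hx => by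
    have := hw.wedge_side (j + 1) (hw.2.2.1 hx)
    rwa [a1, heq] at this
  have h2 : ∀ x ∈ K, -wedge (w j) (w (j + 2)) ≤ wedge (w j + w (j + 2)) x := fun x hx => by
    have := hw.wedge_side (j + 2) (hw.2.2.1 (hK.neg_mem hx))
    rw [a3, hw.1, wedge_neg_right, wedge_neg_right, wedge_swap, neg_neg, ← neg_add',
      wedge_neg_left, neg_neg] at this
    exact this
  have hc : 0 ≤ wedge (w j) (w (j + 2)) := by
    have := h1 0 (interior_subset hK.zero_mem_interior)
    simp only [wedge, Prod.fst_zero, Prod.snd_zero] at this ⊢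
    linarith
  have hc' : 0 < wedge (w j) (w (j + 2)) := hc.lt_of_ne hpq.symm
  set c := wedge (w j) (w (j + 2)) with hcdef
  have f1 : (-c⁻¹) • wedgeLeft (w (j + 2) - w j) ∈ normals K (w j) := by
    refine ⟨?_, fun y hy => ?_⟩
    · simp only [LinearMap.smul_apply, wedgeLeft_apply, wedge_sub_left, wedge_self, smul_eq_mul]
      rw [wedge_swap, ← hcdef]; field_simp; ring
    · simp only [LinearMap.smul_apply, wedgeLeft_apply, smul_eq_mul]
      have := mul_le_mul_of_nonneg_left (h1 y hy) (inv_pos.2 hc').le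
      rw [mul_neg, inv_mul_cancel₀ hc'.ne'] at this
      linarith
  have f2 : (-c⁻¹) • wedgeLeft (w j + w (j + 2)) ∈ normals K (w j) := by
    refine ⟨?_, fun y hy => ?_⟩
    · simp only [LinearMap.smul_apply, wedgeLeft_apply, wedge_add_left, wedge_self,
        smul_eq_mul]
      rw [wedge_swap, ← hcdef]; field_simp; ring
    · simp only [LinearMap.smul_apply, wedgeLeft_apply, smul_eq_mul]
      have := mul_le_mul_of_nonneg_left (h2 y hy) (inv_pos.2 hc').le
      rw [mul_neg, inv_mul_cancel₀ hc'.ne'] at this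
      linarith
  have := congrArg (fun f => f (w (j + 2))) (normals_subsingleton hnc hp f1 f2)
  simp only [LinearMap.smul_apply, wedgeLeft_apply, wedge_add_left, wedge_sub_left,
    wedge_self, smul_eq_mul, ← hcdef] at this
  field_simp at this
  linarith

lemma wedge_pos (hw : IsBalancedHexagon K w) (hK : IsCSCD K) (hnc : NoCorners K)
    (j : ZMod 6) : 0 < wedge (w j) (w (j + 1)) := by
  obtain ⟨x, hx, hneg⟩ := hK.exists_wedge_neg (hw.side_ne_zero hK hnc j)
  have := hw.wedge_side j (hw.2.2.1 hx)
  linarith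

lemma normal_mem (hw : IsBalancedHexagon K w) (hK : IsCSCD K) (hnc : NoCorners K)
    (j : ZMod 6) : (-(wedge (w j) (w (j + 1)))⁻¹) • wedgeLeft (w (j + 1) - w j) ∈
      normals K (sideMid w j) := by
  have hc := hw.wedge_pos hK hnc j
  refine ⟨?_, fun y hy => ?_⟩
  · simp only [LinearMap.smul_apply, wedgeLeft_apply, smul_eq_mul, sideMid_eq, wedge_smul_right,
      wedge_add_right, wedge_sub_left, wedge_self]
    rw [wedge_swap (w (j + 1))]
    field_simp
    ring
  · simp only [LinearMap.smul_apply, wedgeLeft_apply, smul_eq_mul]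
    have := mul_le_mul_of_nonneg_left (hw.wedge_side j (hw.2.2.1 hy)) (inv_pos.2 hc).le
    rw [mul_neg, inv_mul_cancel₀ hc.ne'] at this
    linarith

lemma wedge_add_three (hw : IsBalancedHexagon K w) (x : ℝ × ℝ) (j : ZMod 6) :
    wedge (w (j + 3)) x = -wedge (w j) x := by
  rw [hw.1, wedge_neg_left]

lemma exists_cone (hw : IsBalancedHexagon K w) (hK : IsCSCD K) (hnc : NoCorners K) {x : ℝ × ℝ}
    (hx : x ≠ 0) : ∃ j, 0 ≤ wedge (w j) x ∧ wedge (w (j + 1)) x < 0 := by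
  obtain ⟨i, hi⟩ : ∃ i, wedge (w i) x ≠ 0 := by
    by_contra! h
    exact hx (eq_zero_of_wedge_eq_zero (hw.wedge_pos hK hnc 0).ne' (h _) (h _))
  exact exists_nonneg_neg (σ := fun j => wedge (w j) x) (hw.wedge_add_three x) hi

lemma zero_mem_hull (hw : IsBalancedHexagon K w) (hK : IsCSCD K) :
    (0 : ℝ × ℝ) ∈ convexHull ℝ (Set.range w) :=
  hw.2.2.1 (interior_subset hK.zero_mem_interior)

lemma mem_hull_of_cone (hw : IsBalancedHexagon K w) (hK : IsCSCD K) (hnc : NoCorners K)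
    {x : ℝ × ℝ} {j : ZMod 6} (h1 : 0 ≤ wedge (w j) x) (h2 : wedge (w (j + 1)) x ≤ 0)
    (h3 : -wedge (w j) (w (j + 1)) ≤ wedge (w (j + 1) - w j) x) :
    x ∈ convexHull ℝ (Set.range w) := by
  have hc := hw.wedge_pos hK hnc j
  have hx := wedge_smul_eq (w j) (w (j + 1)) x
  set c := wedge (w j) (w (j + 1)) with hcdef
  rw [wedge_sub_left] at h3
  have hx' : x = (wedge x (w (j + 1)) / c) • w j + (wedge (w j) x / c) • w (j + 1) +
      (1 - wedge x (w (j + 1)) / c - wedge (w j) x / c) • (0 : ℝ × ℝ) := by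
    rw [smul_zero, add_zero, div_eq_inv_mul, div_eq_inv_mul, ← smul_smul, ← smul_smul,
      ← smul_add, ← hx, smul_smul, inv_mul_cancel₀ hc.ne', one_smul]
  rw [wedge_swap] at h2
  have hm := fun i => subset_convexHull ℝ (Set.range w) (Set.mem_range_self i)
  rw [hx']
  have h := Convex.sum_mem (convex_convexHull ℝ (Set.range w)) (t := (Finset.univ : Finset (Fin 3)))
    (w := ![wedge x (w (j + 1)) / c, wedge (w j) x / c,
      1 - wedge x (w (j + 1)) / c - wedge (w j) x / c]) (z := ![w j, w (j + 1), 0])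
    ?_ ?_ ?_
  · simpa [Fin.sum_univ_three] using h
  · intro i _
    fin_cases i
    · exact div_nonneg (by linarith) hc.le
    · exact div_nonneg h1 hc.le
    · change 0 ≤ 1 - wedge x (w (j + 1)) / c - wedge (w j) x / c
      rw [sub_sub, ← add_div, sub_nonneg, div_le_one hc, wedge_swap x]
      linarith
  · simp [Fin.sum_univ_three]
  · intro i _
    fin_cases i
    · exact hm _
    · exact hm _
    · exact hw.zero_mem_hull hK

lemma mem_hull_iff (hw : IsBalancedHexagon K w) (hK : IsCSCD K) (hnc : NoCorners K)
    {x : ℝ × ℝ} : x ∈ convexHull ℝ (Set.range w) ↔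
      ∀ j, ∀ f ∈ normals K (sideMid w j), f x ≤ 1 := by
  have key : ∀ j, ∀ f ∈ normals K (sideMid w j),
      (f x ≤ 1 ↔ -wedge (w j) (w (j + 1)) ≤ wedge (w (j + 1) - w j) x) := fun j f hf => by
    rw [normals_subsingleton hnc (hw.sideMid_mem_frontier j) hf (hw.normal_mem hK hnc j)]
    have hc := hw.wedge_pos hK hnc j
    simp only [LinearMap.smul_apply, wedgeLeft_apply, smul_eq_mul]
    rw [neg_mul, ← div_eq_inv_mul, neg_le, le_div_iff₀ hc, neg_one_mul]
  refine ⟨fun hx j f hf => (key j f hf).2 (hw.wedge_side j hx), fun h => ?_⟩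
  rcases eq_or_ne x 0 with rfl | hx
  · exact hw.zero_mem_hull hK
  obtain ⟨j, h1, h2⟩ := hw.exists_cone hK hnc hx
  have hn := hw.normal_mem hK hnc j
  exact hw.mem_hull_of_cone hK hnc h1 h2.le ((key j _ hn).1 (h j _ hn))

/-- The sum of three consecutive wedge products of vertices of a balanced hexagon is four
times the wedge product of two consecutive midpoints. -/
lemma sum_wedge (hw : IsBalancedHexagon K w) (j : ZMod 6) :
    wedge (w j) (w (j + 1)) + wedge (w (j + 1)) (w (j + 2)) + wedge (w (j + 2)) (w (j + 3)) =
      4 * wedge (sideMid w j) (sideMid w (j + 1)) := by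
  rw [sideMid_eq, sideMid_eq, (zmod_six_add_eq j).1, hw.1]
  simp only [wedge, Prod.smul_fst, Prod.smul_snd, Prod.fst_add, Prod.snd_add, Prod.fst_neg,
    Prod.snd_neg, smul_eq_mul]
  ring

lemma wedge_sideMid_pos (hw : IsBalancedHexagon K w) (hK : IsCSCD K) (hnc : NoCorners K)
    (j : ZMod 6) : 0 < wedge (sideMid w j) (sideMid w (j + 1)) := by
  have h := hw.sum_wedge j
  have h0 := hw.wedge_pos hK hnc j
  have h1 := hw.wedge_pos hK hnc (j + 1)
  have h2 := hw.wedge_pos hK hnc (j + 2)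
  rw [(zmod_six_add_eq j).1] at h1
  rw [(zmod_six_add_eq j).2.2.1] at h2
  linarith

end IsBalancedHexagon

/-! ### Balanced hexagons with a common midpoint -/

lemma normals_eq_of_mem {K : Set (ℝ × ℝ)} (hnc : NoCorners K) {p q : ℝ × ℝ}
    (hp : p ∈ frontier K) (hq : q ∈ frontier K) {g : (ℝ × ℝ) →ₗ[ℝ] ℝ}
    (hgp : g ∈ normals K p) (hgq : g ∈ normals K q) : normals K p = normals K q := by
  ext f
  exact ⟨fun hf => normals_subsingleton hnc hp hf hgp ▸ hgq,
    fun hf => normals_subsingleton hnc hq hf hgq ▸ hgp⟩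

lemma normals_neg_eq {K : Set (ℝ × ℝ)} (hK : IsCSCD K) {p q : ℝ × ℝ}
    (h : normals K p = normals K q) : normals K (-p) = normals K (-q) := by
  have key : ∀ {p q : ℝ × ℝ}, normals K p = normals K q →
      normals K (-p) ⊆ normals K (-q) := fun {p q} h f hf => by
    have := neg_mem_normals hK hf
    rw [neg_neg, h] at this
    have := neg_mem_normals hK this
    rwa [neg_neg] at this
  exact (key h).antisymm (key h.symm)

/-- Overlapping boundary chords on a common line have the same normals at all end points. -/
lemma normals_eq_of_overlap {K : Set (ℝ × ℝ)} (hK : IsCSCD K) (hnc : NoCorners K)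
    {u v v' : ℝ × ℝ} (hv : v ∈ frontier K) (hvu : v - u ∈ frontier K) (hv' : v' ∈ frontier K)
    (hvu' : v' - u ∈ frontier K) {g : (ℝ × ℝ) →ₗ[ℝ] ℝ} (hg : g ∈ normals K v) {t : ℝ}
    (ht : 0 < t) (hvv : v' = v + t • u) :
    normals K v = normals K v' ∧ normals K (v - u) = normals K (v' - u) := by
  have g1 := hg.1
  have gu : g u = 0 := by
    have h1 := hg.2 _ (hK.frontier_subset hvu)
    have h2 := hg.2 _ (hK.frontier_subset hv')
    rw [map_sub] at h1
    rw [hvv, map_add, map_smul, smul_eq_mul] at h2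
    nlinarith
  have gv' : g ∈ normals K v' := ⟨by rw [hvv, map_add, map_smul, gu, g1]; simp, hg.2⟩
  exact ⟨normals_eq_of_mem hnc hv hv' hg gv',
    normals_eq_of_mem hnc hvu hvu' (g := g) ⟨by rw [map_sub, gu, g1, sub_zero], hg.2⟩
      ⟨by rw [map_sub, gu, gv'.1, sub_zero], hg.2⟩⟩

namespace IsBalancedHexagon

variable {K : Set (ℝ × ℝ)} {w w' : ZMod 6 → ℝ × ℝ}

lemma sideMid_two_mem (hw : IsBalancedHexagon K w) :
    sideMid w 1 - sideMid w 0 ∈ frontier K := by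
  have h := hw.sideMid_mem_frontier (0 + 2)
  rwa [hw.sideMid_add_two, zero_add] at h

lemma wedge_sideMid_le (hw : IsBalancedHexagon K w) (hw' : IsBalancedHexagon K w')
    (hK : IsCSCD K) (hnc : NoCorners K) (h0 : sideMid w 0 = sideMid w' 0) :
    wedge (sideMid w 0) (sideMid w' 1) ≤ wedge (sideMid w 0) (sideMid w 1) := by
  have hf := hK.frontier_subset
  have n2 := hw.normal_mem hK hnc (0 + 2)
  rw [hw.sideMid_add_two, zero_add] at n2
  exact wedge_le_of_normals (hK.ne_zero_of_mem_frontier (hw.sideMid_mem_frontier 0))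
    (hf (hw.sideMid_mem_frontier 0)) (hf (hw.sideMid_mem_frontier 1)) (hf hw.sideMid_two_mem)
    (hf (hw'.sideMid_mem_frontier 1)) (by rw [h0]; exact hf hw'.sideMid_two_mem)
    (hw.normal_mem hK hnc 1) n2 (by simpa using (hw.wedge_sideMid_pos hK hnc 0).le)

/-- Balanced hexagons with a common midpoint are equal as sets. -/
lemma hull_eq (hw : IsBalancedHexagon K w) (hw' : IsBalancedHexagon K w')
    (hK : IsCSCD K) (hnc : NoCorners K) (h0 : sideMid w 0 = sideMid w' 0) :
    convexHull ℝ (Set.range w) = convexHull ℝ (Set.range w') := by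
  have hle := hw.wedge_sideMid_le hw' hK hnc h0
  have hge := hw'.wedge_sideMid_le hw hK hnc h0.symm
  rw [← h0] at hge
  obtain ⟨t, ht⟩ := exists_smul_of_wedge_eq_zero (x := sideMid w' 1 - sideMid w 1)
    (hK.ne_zero_of_mem_frontier (hw.sideMid_mem_frontier 0))
    (by rw [wedge_sub_right, sub_eq_zero]; exact hle.antisymm hge)
  have m2 := hw.sideMid_two_mem
  have m2' := hw'.sideMid_two_mem
  rw [← h0] at m2'
  have key : normals K (sideMid w 1) = normals K (sideMid w' 1) ∧
      normals K (sideMid w 1 - sideMid w 0) = normals K (sideMid w' 1 - sideMid w 0) := by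
    rcases lt_trichotomy t 0 with h | h | h
    · have := normals_eq_of_overlap hK hnc (hw'.sideMid_mem_frontier 1) m2'
        (hw.sideMid_mem_frontier 1) m2 (hw'.normal_mem hK hnc 1) (neg_pos.2 h)
        (by rw [neg_smul, ← ht]; abel)
      exact ⟨this.1.symm, this.2.symm⟩
    · rw [h, zero_smul, sub_eq_zero] at ht
      rw [ht]
      exact ⟨rfl, rfl⟩
    · exact normals_eq_of_overlap hK hnc (hw.sideMid_mem_frontier 1) m2
        (hw'.sideMid_mem_frontier 1) m2' (hw.normal_mem hK hnc 1) h
        (by rw [← ht]; abel)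
  have hall : ∀ j, normals K (sideMid w j) = normals K (sideMid w' j) := by
    have e0 : normals K (sideMid w 0) = normals K (sideMid w' 0) := by rw [h0]
    have e1 : normals K (sideMid w (0 + 1)) = normals K (sideMid w' (0 + 1)) := by
      simpa only [zero_add] using key.1
    have e2 : normals K (sideMid w (0 + 2)) = normals K (sideMid w' (0 + 2)) := by
      rw [hw.sideMid_add_two, hw'.sideMid_add_two, ← h0]
      simpa only [zero_add] using key.2
    have step : ∀ j, normals K (sideMid w j) = normals K (sideMid w' j) →
        normals K (sideMid w (j + 3)) = normals K (sideMid w' (j + 3)) := fun j h => by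
      rw [hw.sideMid_add_three, hw'.sideMid_add_three]
      exact normals_neg_eq hK h
    have e3 := step _ e0
    have e4 := step _ e1
    have e5 := step _ e2
    rw [add_assoc, show (1 : ZMod 6) + 3 = 4 from rfl] at e4
    rw [add_assoc, show (2 : ZMod 6) + 3 = 5 from rfl] at e5
    intro j
    induction j using forall_zmod_six 0 with
    | h0 => exact e0
    | h1 => exact e1
    | h2 => exact e2
    | h3 => exact e3
    | h4 => exact e4
    | h5 => exact e5
  ext x
  rw [hw.mem_hull_iff hK hnc, hw'.mem_hull_iff hK hnc]
  simp only [hall]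

end IsBalancedHexagon

/-! ### The area of a balanced hexagon -/

lemma volume_standard_triangle :
    volume {p : ℝ × ℝ | 0 ≤ p.2 ∧ 0 < p.1 ∧ p.1 + p.2 ≤ 1} = ENNReal.ofReal (1 / 2) := by
  have hm : MeasurableSet {p : ℝ × ℝ | 0 ≤ p.2 ∧ 0 < p.1 ∧ p.1 + p.2 ≤ 1} := by
    apply MeasurableSet.inter (measurableSet_le measurable_const measurable_snd)
    exact MeasurableSet.inter (measurableSet_lt measurable_const measurable_fst)
      (measurableSet_le (measurable_fst.add measurable_snd) measurable_const)
  rw [Measure.volume_eq_prod, Measure.prod_apply hm]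
  have hslice : ∀ x : ℝ, volume (Prod.mk x ⁻¹' {p : ℝ × ℝ | 0 ≤ p.2 ∧ 0 < p.1 ∧ p.1 + p.2 ≤ 1}) =
      (Set.Ioc (0 : ℝ) 1).indicator (fun x => ENNReal.ofReal (1 - x)) x := fun x => by
    by_cases hx : 0 < x
    · have : Prod.mk x ⁻¹' {p : ℝ × ℝ | 0 ≤ p.2 ∧ 0 < p.1 ∧ p.1 + p.2 ≤ 1} =
          Set.Icc 0 (1 - x) := by
        ext y
        simp only [Set.mem_preimage, Set.mem_ofPred_eq, Set.mem_Icc]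
        constructor
        · rintro ⟨h1, -, h2⟩; exact ⟨h1, by linarith⟩
        · rintro ⟨h1, h2⟩; exact ⟨h1, hx, by linarith⟩
      rw [this, Real.volume_Icc, sub_zero]
      by_cases hx1 : x ≤ 1
      · rw [Set.indicator_of_mem (show x ∈ Set.Ioc 0 1 from ⟨hx, hx1⟩)]
      · rw [Set.indicator_of_notMem fun h => hx1 h.2, ENNReal.ofReal_of_nonpos (by linarith)]
    · have : Prod.mk x ⁻¹' {p : ℝ × ℝ | 0 ≤ p.2 ∧ 0 < p.1 ∧ p.1 + p.2 ≤ 1} = ∅ := by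
        ext y
        simp [hx]
      rw [this, Set.indicator_of_notMem fun h => hx h.1, measure_empty]
  simp_rw [hslice]
  rw [lintegral_indicator measurableSet_Ioc, ← ofReal_integral_eq_lintegral_ofReal,
    ← intervalIntegral.integral_of_le zero_le_one]
  · congr 1
    rw [intervalIntegral.integral_sub (by simp) (by simp)]
    norm_num
  · exact (Continuous.integrableOn_Icc (by fun_prop)).mono_set Set.Ioc_subset_Icc_self
  · refine (ae_restrict_iff' measurableSet_Ioc).2 (Filter.Eventually.of_forall fun x hx => ?_)
    simpa using hx.2

/-- The half-open triangle with vertices `0`, `v`, `w`, for `wedge v w > 0`. -/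
def halfOpenTriangle (v w : ℝ × ℝ) : Set (ℝ × ℝ) :=
  {x | 0 ≤ wedge v x ∧ wedge w x < 0 ∧ -wedge v w ≤ wedge (w - v) x}

lemma measurableSet_halfOpenTriangle (v w : ℝ × ℝ) : MeasurableSet (halfOpenTriangle v w) := by
  have hm : ∀ v, Measurable (wedge v) := fun v => by
    have : Continuous (wedge v) := by unfold wedge; fun_prop
    exact this.measurable
  apply MeasurableSet.inter (measurableSet_le measurable_const (hm v))
  exact MeasurableSet.inter (measurableSet_lt (hm w) measurable_const)
    (measurableSet_le measurable_const (hm _))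

lemma volume_halfOpenTriangle {v w : ℝ × ℝ} (h : 0 < wedge v w) :
    volume (halfOpenTriangle v w) = ENNReal.ofReal (wedge v w / 2) := by
  set f : (ℝ × ℝ) →ₗ[ℝ] (ℝ × ℝ) := Matrix.toLin (Module.Basis.finTwoProd ℝ)
    (Module.Basis.finTwoProd ℝ) !![v.1, w.1; v.2, w.2] with hf
  have hfa : ∀ x, f x = x.1 • v + x.2 • w := fun x => by
    rw [hf, Matrix.toLin_finTwoProd_apply]
    ext <;> simp [mul_comm]
  have hdet : LinearMap.det f = wedge v w := by
    rw [hf, LinearMap.det_toLin, Matrix.det_fin_two_of, wedge]; ring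
  have himg : halfOpenTriangle v w =
      f '' {p : ℝ × ℝ | 0 ≤ p.2 ∧ 0 < p.1 ∧ p.1 + p.2 ≤ 1} := by
    have hself := wedge_self
    ext x
    simp only [halfOpenTriangle, Set.mem_ofPred_eq, Set.mem_image]
    constructor
    · rintro ⟨h1, h2, h3⟩
      rw [wedge_swap] at h2
      rw [wedge_sub_left, wedge_swap w x] at h3
      refine ⟨(wedge x w / wedge v w, wedge v x / wedge v w),
        ⟨div_nonneg h1 h.le, div_pos (by linarith) h, ?_⟩, ?_⟩
      · rw [← add_div, div_le_one h]; linarith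
      · rw [hfa, div_eq_inv_mul, div_eq_inv_mul, ← smul_smul, ← smul_smul, ← smul_add,
          ← wedge_smul_eq, smul_smul, inv_mul_cancel₀ h.ne', one_smul]
    · rintro ⟨⟨s, t⟩, ⟨h1, h2, h3⟩, rfl⟩
      simp only at h1 h2 h3
      simp only [hfa, wedge_add_right, wedge_smul_right, wedge_sub_left, hself, wedge_swap w v]
      refine ⟨?_, ?_, ?_⟩ <;> nlinarith
  rw [himg, Measure.addHaar_image_linearMap, hdet, volume_standard_triangle, abs_of_pos h,
    ← ENNReal.ofReal_mul h.le]
  congr 1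
  ring

namespace IsBalancedHexagon

variable {K : Set (ℝ × ℝ)} {w : ZMod 6 → ℝ × ℝ}

lemma cone_unique (hw : IsBalancedHexagon K w) (hK : IsCSCD K) (hnc : NoCorners K) {x : ℝ × ℝ}
    {i j : ZMod 6} (hi : 0 ≤ wedge (w i) x ∧ wedge (w (i + 1)) x < 0)
    (hj : 0 ≤ wedge (w j) x ∧ wedge (w (j + 1)) x < 0) : i = j := by
  by_contra hij
  obtain ⟨a1, a2, a3, a4⟩ := zmod_six_add_eq i
  have c0 := hw.wedge_pos hK hnc i
  have c1 := hw.wedge_pos hK hnc (i + 1)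
  have c2 := hw.wedge_pos hK hnc (i + 2)
  rw [a1] at c1
  rw [a3, hw.1, wedge_neg_right, wedge_swap, neg_neg] at c2
  have rel : wedge (w (i + 1)) (w (i + 2)) * wedge (w i) x +
      wedge (w i) (w (i + 1)) * wedge (w (i + 2)) x =
      wedge (w i) (w (i + 2)) * wedge (w (i + 1)) x := by
    simp only [wedge]; ring
  have h2 : wedge (w (i + 2)) x < 0 := by
    by_contra! h
    nlinarith [mul_nonneg c1.le hi.1, mul_nonneg c0.le h,
      mul_pos_of_neg_of_neg (neg_lt_zero.2 c2) hi.2]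
  have e4 := hw.wedge_add_three x (i + 1)
  have e5 := hw.wedge_add_three x (i + 2)
  have b4 : i + 1 + 3 = i + 4 := by ring
  have b5 : i + 2 + 3 = i + 5 := by ring
  have b6 : i + 5 + 1 = i := by
    have : (5 : ZMod 6) + 1 = 0 := rfl
    rw [add_assoc, this, add_zero]
  have b7 : i + 3 + 1 = i + 4 := by ring
  have b8 : i + 4 + 1 = i + 5 := by ring
  rw [b4] at e4
  rw [b5] at e5
  have e3 := hw.wedge_add_three x i
  induction j using forall_zmod_six i
  · exact hij rfl
  · linarith [hj.1, hi.2]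
  · linarith [hj.1, h2]
  · rw [b7] at hj; linarith [hj.2, hi.2]
  · rw [b8] at hj; linarith [hj.2]
  · rw [b6] at hj; linarith [hj.2, hi.1]

lemma hull_diff_zero (hw : IsBalancedHexagon K w) (hK : IsCSCD K) (hnc : NoCorners K) :
    convexHull ℝ (Set.range w) \ {0} = ⋃ j, halfOpenTriangle (w j) (w (j + 1)) := by
  ext x
  simp only [Set.mem_sdiff, Set.mem_singleton_iff, Set.mem_iUnion, halfOpenTriangle,
    Set.mem_ofPred_eq]
  constructor
  · rintro ⟨hx, hx0⟩
    obtain ⟨j, h1, h2⟩ := hw.exists_cone hK hnc hx0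
    exact ⟨j, h1, h2, hw.wedge_side j hx⟩
  · rintro ⟨j, h1, h2, h3⟩
    refine ⟨hw.mem_hull_of_cone hK hnc h1 h2.le h3, ?_⟩
    rintro rfl
    simp [wedge] at h2

lemma volume_hull (hw : IsBalancedHexagon K w) (hK : IsCSCD K) (hnc : NoCorners K) :
    (volume (convexHull ℝ (Set.range w))).toReal =
      4 * wedge (sideMid w 0) (sideMid w 1) := by
  have hpos := fun j => hw.wedge_pos hK hnc j
  have hvol : volume (convexHull ℝ (Set.range w)) =
      ENNReal.ofReal (∑ j, wedge (w j) (w (j + 1)) / 2) := by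
    rw [← measure_sdiff_null (s := convexHull ℝ (Set.range w)) (t := {0}) (measure_singleton _),
      hw.hull_diff_zero hK hnc, measure_iUnion _ fun j => measurableSet_halfOpenTriangle _ _,
      tsum_fintype, ENNReal.ofReal_sum_of_nonneg fun j _ => by have := hpos j; positivity]
    · exact Finset.sum_congr rfl fun j _ => volume_halfOpenTriangle (hpos j)
    · intro i j hij
      refine Set.disjoint_left.2 fun x hi hj => hij ?_
      exact hw.cone_unique hK hnc ⟨hi.1, hi.2.1⟩ ⟨hj.1, hj.2.1⟩
  rw [hvol, ENNReal.toReal_ofReal (Finset.sum_nonneg fun j _ => by have := hpos j; positivity)]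
  have hs := hw.sum_wedge 0
  have hsum : ∀ f : ZMod 6 → ℝ, (∀ j, f (j + 3) = f j) →
      ∑ j, f j / 2 = f 0 + f 1 + f 2 := fun f hf => by
    have e3 : f 3 = f 0 := hf 0
    have e4 : f 4 = f 1 := hf 1
    have e5 : f 5 = f 2 := hf 2
    have : ∑ j, f j / 2 = f 0 / 2 + f 1 / 2 + f 2 / 2 + f 3 / 2 + f 4 / 2 + f 5 / 2 :=
      Fin.sum_univ_six (fun j : Fin 6 => f j / 2)
    rw [this, e3, e4, e5]
    ring
  rw [hsum _ fun j => by
    rw [hw.1, add_right_comm, hw.1, wedge_neg_left, wedge_neg_right, neg_neg]]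
  simp only [zero_add] at hs
  exact hs

end IsBalancedHexagon

/-! ### Lattice packings -/

lemma interior_image_add (K : Set (ℝ × ℝ)) (p : ℝ × ℝ) :
    interior ((fun x => p + x) '' K) = (fun x => p + x) '' interior K :=
  ((Homeomorph.addLeft p).image_interior K).symm

/-- Translates by a difference-closed set form a packing as soon as no half of a nonzero element
lies in the interior. -/
lemma isPacking_of_half_notMem {K L : Set (ℝ × ℝ)} (hK : IsCSCD K)
    (hL : ∀ p ∈ L, ∀ q ∈ L, p - q ∈ L)
    (h : ∀ p ∈ L, p ≠ 0 → (1 / 2 : ℝ) • p ∉ interior K) : IsPacking K L := by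
  intro p hp q hq hpq
  rw [interior_image_add, interior_image_add, Set.eq_empty_iff_forall_notMem]
  rintro _ ⟨⟨x, hx, rfl⟩, y, hy, hxy⟩
  refine h _ (hL p hp q hq) (sub_ne_zero.2 hpq) ?_
  have := hK.1.interior hy (hK.neg_mem_interior hx) (a := 1 / 2) (b := 1 / 2)
    (by norm_num) (by norm_num) (by norm_num)
  have he : p - q = y - x := by
    rw [sub_eq_sub_iff_add_eq_add, add_comm y]
    exact hxy.symm
  rwa [he, sub_eq_add_neg, smul_add]

lemma IsPacking.half_notMem {K L : Set (ℝ × ℝ)} (hK : IsCSCD K) (h : IsPacking K L)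
    (h0 : (0 : ℝ × ℝ) ∈ L) {p : ℝ × ℝ} (hp : p ∈ L) (hp0 : p ≠ 0) :
    (1 / 2 : ℝ) • p ∉ interior K := by
  intro hm
  have := h p hp 0 h0 hp0
  rw [interior_image_add, interior_image_add] at this
  refine Set.eq_empty_iff_forall_notMem.1 this ((1 / 2 : ℝ) • p)
    ⟨⟨_, hK.neg_mem_interior hm, ?_⟩, _, hm, zero_add _⟩
  module

lemma latticeOf_sub_mem {v w p q : ℝ × ℝ} (hp : p ∈ latticeOf v w) (hq : q ∈ latticeOf v w) :
    p - q ∈ latticeOf v w := by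
  obtain ⟨m, n, rfl⟩ := hp
  obtain ⟨m', n', rfl⟩ := hq
  exact ⟨m - m', n - n', by push_cast; module⟩

lemma zero_mem_latticeOf (v w : ℝ × ℝ) : (0 : ℝ × ℝ) ∈ latticeOf v w := ⟨0, 0, by simp⟩

/-- In the lattice generated by two consecutive vertices of an inscribed affinely regular hexagon
with supporting functionals at its vertices, only `0` is interior. -/
lemma combination_notMem_interior {K : Set (ℝ × ℝ)} (hK : IsCSCD K) {u v : ℝ × ℝ}
    {f g h : (ℝ × ℝ) →ₗ[ℝ] ℝ} (hu : u ∈ K) (hv : v ∈ K) (hvu : v - u ∈ K)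
    (hf : f ∈ normals K u) (hg : g ∈ normals K v) (hh : h ∈ normals K (v - u)) {m n : ℤ}
    (hmn : m ≠ 0 ∨ n ≠ 0) : (m : ℝ) • u + (n : ℝ) • v ∉ interior K := by
  intro hm
  have f1 := abs_lt.1 (abs_lt_one_of_mem_normals hK hf hm)
  have g1 := abs_lt.1 (abs_lt_one_of_mem_normals hK hg hm)
  have h1 := abs_lt.1 (abs_lt_one_of_mem_normals hK hh hm)
  have fu := hf.1
  have gv := hg.1
  have hvu1 := hh.1
  have f2 := abs_le.1 (abs_le_one_of_mem_normals hK hf hvu)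
  have g2 := hg.2 _ hvu
  have h2 := hh.2 _ hv
  have h3 := abs_le.1 (abs_le_one_of_mem_normals hK hh hu)
  simp only [map_add, map_smul, map_sub, smul_eq_mul, fu, gv] at f1 g1 h1 f2 g2 hvu1
  have hhv : h v = 1 + h u := by linarith
  rw [hhv] at h1
  rcases lt_trichotomy m 0 with hm0 | hm0 | hm0
  · have hm1 : (m : ℝ) ≤ -1 := by exact_mod_cast (show m ≤ -1 by omega)
    rcases le_or_gt n 0 with hn | hn
    · have hn1 : (n : ℝ) ≤ 0 := by exact_mod_cast hn
      nlinarith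
    · have hn1 : (1 : ℝ) ≤ n := by exact_mod_cast hn
      nlinarith
  · have hn := hmn.resolve_left (by simp [hm0])
    rw [hm0] at g1
    rcases lt_or_gt_of_ne hn with hn | hn
    · have hn1 : (n : ℝ) ≤ -1 := by exact_mod_cast (show n ≤ -1 by omega)
      norm_num at g1
      linarith
    · have hn1 : (1 : ℝ) ≤ n := by exact_mod_cast hn
      norm_num at g1
      linarith
  · have hm1 : (1 : ℝ) ≤ m := by exact_mod_cast hm0
    rcases lt_or_ge n 0 with hn | hn
    · have hn1 : (n : ℝ) ≤ -1 := by exact_mod_cast (show n ≤ -1 by omega)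
      nlinarith
    · have hn1 : (0 : ℝ) ≤ n := by exact_mod_cast hn
      nlinarith

/-- The doubled midpoints of a balanced hexagon generate a packing lattice. -/
lemma IsBalancedHexagon.isPacking {K : Set (ℝ × ℝ)} {w : ZMod 6 → ℝ × ℝ}
    (hw : IsBalancedHexagon K w) (hK : IsCSCD K) (hnc : NoCorners K) :
    IsPacking K (latticeOf ((2 : ℝ) • sideMid w 0) ((2 : ℝ) • sideMid w 1)) := by
  refine isPacking_of_half_notMem hK (fun p hp q hq => latticeOf_sub_mem hp hq) ?_
  rintro _ ⟨m, n, rfl⟩ hne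
  have hf := hK.frontier_subset
  have n2 := hw.normal_mem hK hnc (0 + 2)
  rw [hw.sideMid_add_two, zero_add] at n2
  have := combination_notMem_interior hK (hf (hw.sideMid_mem_frontier 0))
    (hf (hw.sideMid_mem_frontier 1)) (hf hw.sideMid_two_mem) (hw.normal_mem hK hnc 0)
    (hw.normal_mem hK hnc 1) n2 (m := m) (n := n) (by
      by_contra! h
      exact hne (by simp [h.1, h.2]))
  have he : (1 / 2 : ℝ) • ((m : ℝ) • (2 : ℝ) • sideMid w 0 + (n : ℝ) • (2 : ℝ) • sideMid w 1) =
      (m : ℝ) • sideMid w 0 + (n : ℝ) • sideMid w 1 := by module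
  rwa [he]

/-! ### The lower bound for the covolume of a packing lattice -/

lemma exists_norm_le_gauge {K : Set (ℝ × ℝ)} (hK : IsCSCD K) :
    ∃ R : ℝ, 0 < R ∧ ∀ x, ‖x‖ ≤ R * gauge K x := by
  obtain ⟨R, hR, hsub⟩ := hK.2.1.isBounded.subset_closedBall_lt 0 0
  refine ⟨R, hR, fun x => ?_⟩
  have := le_gauge_of_subset_closedBall (absorbent_nhds_zero hK.mem_nhds_zero) hR.le hsub (x := x)
  rwa [div_le_iff₀' hR] at this

lemma abs_wedge_le (v w : ℝ × ℝ) : |wedge v w| ≤ 2 * ‖v‖ * ‖w‖ := by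
  have h1 := norm_fst_le v
  have h2 := norm_snd_le v
  have h3 := norm_fst_le w
  have h4 := norm_snd_le w
  rw [Real.norm_eq_abs] at h1 h2 h3 h4
  calc |wedge v w| ≤ |v.1 * w.2| + |v.2 * w.1| := abs_sub _ _
    _ = |v.1| * |w.2| + |v.2| * |w.1| := by rw [abs_mul, abs_mul]
    _ ≤ ‖v‖ * ‖w‖ + ‖v‖ * ‖w‖ := by gcongr
    _ = 2 * ‖v‖ * ‖w‖ := by ring

/-- A lattice has a nonzero vector of minimal gauge. -/
lemma exists_min_gauge {K : Set (ℝ × ℝ)} (hK : IsCSCD K) {v w : ℝ × ℝ} (hvw : wedge v w ≠ 0) :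
    ∃ z : ℤ × ℤ, z ≠ 0 ∧ ∀ y : ℤ × ℤ, y ≠ 0 →
      gauge K ((z.1 : ℝ) • v + (z.2 : ℝ) • w) ≤ gauge K ((y.1 : ℝ) • v + (y.2 : ℝ) • w) := by
  obtain ⟨R, hR, hle⟩ := exists_norm_le_gauge hK
  set F : ℤ × ℤ → ℝ := fun z => gauge K ((z.1 : ℝ) • v + (z.2 : ℝ) • w) with hF
  have hD : 0 < |wedge v w| := abs_pos.2 hvw
  obtain ⟨B, hB⟩ := exists_nat_ge (2 * (R * F (1, 0)) * (‖v‖ + ‖w‖) / |wedge v w|)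
  rw [div_le_iff₀ hD] at hB
  have hF0 : 0 ≤ 2 * (R * F (1, 0)) :=
    mul_nonneg zero_le_two (mul_nonneg hR.le (gauge_nonneg _))
  set S : Set (ℤ × ℤ) := {z | z ≠ 0 ∧ F z ≤ F (1, 0)} with hS
  have hfin : S.Finite := by
    refine (Set.finite_Icc ((-B, -B) : ℤ × ℤ) (B, B)).subset ?_
    rintro ⟨m, n⟩ ⟨-, hz⟩
    set x := (m : ℝ) • v + (n : ℝ) • w with hx
    have hxn : ‖x‖ ≤ R * F (1, 0) := (hle x).trans (by gcongr)
    have hm : |(m : ℝ)| * |wedge v w| ≤ B * |wedge v w| := by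
      calc |(m : ℝ)| * |wedge v w| = |wedge x w| := by
            rw [hx, wedge_add_left, wedge_smul_left, wedge_smul_left, wedge_self, mul_zero,
              add_zero, abs_mul]
        _ ≤ 2 * ‖x‖ * ‖w‖ := abs_wedge_le _ _
        _ ≤ 2 * (R * F (1, 0)) * (‖v‖ + ‖w‖) := by
            gcongr
            exact le_add_of_nonneg_left (norm_nonneg v)
        _ ≤ B * |wedge v w| := hB
    have hn : |(n : ℝ)| * |wedge v w| ≤ B * |wedge v w| := by
      calc |(n : ℝ)| * |wedge v w| = |wedge x v| := by
            rw [hx, wedge_add_left, wedge_smul_left, wedge_smul_left, wedge_self, mul_zero,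
              zero_add, abs_mul, wedge_swap w v, abs_neg]
        _ ≤ 2 * ‖x‖ * ‖v‖ := abs_wedge_le _ _
        _ ≤ 2 * (R * F (1, 0)) * (‖v‖ + ‖w‖) := by
            gcongr
            exact le_add_of_nonneg_right (norm_nonneg w)
        _ ≤ B * |wedge v w| := hB
    have hm' : |m| ≤ (B : ℤ) := by exact_mod_cast le_of_mul_le_mul_right hm hD
    have hn' : |n| ≤ (B : ℤ) := by exact_mod_cast le_of_mul_le_mul_right hn hD
    exact ⟨⟨(abs_le.1 hm').1, (abs_le.1 hn').1⟩, (abs_le.1 hm').2, (abs_le.1 hn').2⟩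
  obtain ⟨z, hz, hmin⟩ := Set.exists_min_image S F hfin ⟨(1, 0), by simp, le_rfl⟩
  refine ⟨z, hz.1, fun y hy => ?_⟩
  rcases le_or_gt (F y) (F (1, 0)) with h | h
  · exact hmin y ⟨hy, h⟩
  · exact hz.2.trans h.le

lemma wedge_ne_zero_left {v w : ℝ × ℝ} (h : wedge v w ≠ 0) : v ≠ 0 := by
  rintro rfl
  simp [wedge] at h

/-- A lattice has a nonzero vector `l` of minimal gauge, and a vector `l'` completing it to a
positively oriented basis. -/
lemma exists_basis_min_gauge {K : Set (ℝ × ℝ)} (hK : IsCSCD K) {v w : ℝ × ℝ}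
    (hvw : wedge v w ≠ 0) :
    ∃ l ∈ latticeOf v w, ∃ l' ∈ latticeOf v w, wedge l l' = |wedge v w| ∧
      ∀ y ∈ latticeOf v w, y ≠ 0 → gauge K l ≤ gauge K y := by
  obtain ⟨⟨m, n⟩, hz, hmin⟩ := exists_min_gauge hK hvw
  have hli : ∀ a b : ℤ, (a : ℝ) • v + (b : ℝ) • w = 0 → (a, b) = ((0, 0) : ℤ × ℤ) :=
    fun a b h => by
      have h1 := congrArg (fun x => wedge x w) h
      have h2 := congrArg (fun x => wedge v x) h
      simp only [wedge_add_left, wedge_smul_left, wedge_add_right, wedge_smul_right,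
        wedge_self] at h1 h2
      have z1 : wedge 0 w = 0 := by simp [wedge]
      have z2 : wedge v 0 = 0 := by simp [wedge]
      rw [z1, mul_zero, add_zero] at h1
      rw [z2, mul_zero, zero_add] at h2
      have ha := (mul_eq_zero.1 h1).resolve_right hvw
      have hb := (mul_eq_zero.1 h2).resolve_right hvw
      rw [Prod.mk.injEq]
      exact ⟨by exact_mod_cast ha, by exact_mod_cast hb⟩
  have hgcd : Int.gcd m n = 1 := by
    obtain ⟨m', hm'⟩ := Int.gcd_dvd_left m n
    obtain ⟨n', hn'⟩ := Int.gcd_dvd_right m n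
    set d := Int.gcd m n with hd
    have hd0 : d ≠ 0 := fun h => hz (by
      rw [Int.gcd_eq_zero_iff] at h
      rw [h.1, h.2]; rfl)
    have hne : ((m', n') : ℤ × ℤ) ≠ 0 := fun h => by
      rw [Prod.mk_eq_zero] at h
      apply hz
      rw [hm', hn', h.1, h.2, mul_zero]; rfl
    set x := (m' : ℝ) • v + (n' : ℝ) • w with hx
    have h1 : gauge K ((m : ℝ) • v + (n : ℝ) • w) = d * gauge K x := by
      rw [← smul_eq_mul, ← gauge_smul_of_nonneg (Nat.cast_nonneg d), hx, hm', hn']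
      congr 1
      push_cast
      module
    have h2 : gauge K ((m : ℝ) • v + (n : ℝ) • w) ≤ gauge K x := hmin (m', n') hne
    have hxpos : 0 < gauge K x := by
      obtain ⟨R, hR, hle⟩ := exists_norm_le_gauge hK
      have : 0 < ‖x‖ := norm_pos_iff.2 fun h => hne (hli _ _ h)
      exact pos_of_mul_pos_right (this.trans_le (hle x)) hR.le
    rw [h1] at h2
    have : (d : ℝ) ≤ 1 := by nlinarith
    have : d ≤ 1 := by exact_mod_cast this
    omega
  have hbez := Int.gcd_eq_gcd_ab m n
  rw [hgcd] at hbez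
  set a := Int.gcdA m n
  set b := Int.gcdB m n
  have hbez' : (1 : ℝ) = m * a + n * b := by exact_mod_cast hbez
  have hmin' : ∀ y ∈ latticeOf v w, y ≠ 0 →
      gauge K ((m : ℝ) • v + (n : ℝ) • w) ≤ gauge K y := by
    rintro _ ⟨k, l, rfl⟩ hy
    refine hmin (k, l) fun h => hy ?_
    rw [Prod.mk_eq_zero] at h
    simp [h.1, h.2]
  have hw : wedge ((m : ℝ) • v + (n : ℝ) • w) ((-b : ℝ) • v + (a : ℝ) • w) = wedge v w := by
    simp only [wedge_add_left, wedge_smul_left, wedge_add_right, wedge_smul_right, wedge_self,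
      wedge_swap w v]
    linear_combination (-wedge v w) * hbez'
  rcases lt_or_gt_of_ne hvw with h | h
  · refine ⟨_, ⟨m, n, rfl⟩, _, ⟨b, -a, rfl⟩, ?_, hmin'⟩
    rw [abs_of_neg h, ← hw, ← wedge_neg_right]
    congr 1
    push_cast
    module
  · refine ⟨_, ⟨m, n, rfl⟩, _, ⟨-b, a, rfl⟩, ?_, hmin'⟩
    rw [abs_of_pos h, ← hw]
    congr 1
    push_cast
    module

/-- If `p`, `v` and `v - p` belong to `K`, then every point at positive height less than
that of `v` over `p` can be translated by a multiple of `p` to a point of gauge less than `1`. -/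
lemma exists_gauge_add_lt_one {K : Set (ℝ × ℝ)} (hK : IsCSCD K) {p v y : ℝ × ℝ} (hp : p ∈ K)
    (hv : v ∈ K) (hvp : v - p ∈ K) (hp0 : p ≠ 0) (hy : 0 < wedge p y)
    (hlt : wedge p y < wedge p v) : ∃ n : ℤ, gauge K (y + (n : ℝ) • p) < 1 := by
  have hpv : 0 < wedge p v := hy.trans hlt
  set k := wedge p y / wedge p v with hk
  have hk0 : 0 < k := by positivity
  have hk1 : k < 1 := (div_lt_one hpv).2 hlt
  obtain ⟨s, hs⟩ := exists_smul_of_wedge_eq_zero (x := y - k • v) hp0 (by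
    rw [wedge_sub_right, wedge_smul_right, hk]; field_simp; ring)
  have hsub : ∀ {a b : ℝ} {x z : ℝ × ℝ}, 0 ≤ a → 0 ≤ b → x ∈ K → z ∈ K →
      gauge K (a • x + b • z) ≤ a + b := fun {a b x z} ha hb hx hz => by
    refine (gauge_add_le hK.1 (absorbent_nhds_zero hK.mem_nhds_zero) _ _).trans ?_
    rw [gauge_smul_of_nonneg ha, gauge_smul_of_nonneg hb, smul_eq_mul, smul_eq_mul]
    have := gauge_le_one_of_mem hx
    have := gauge_le_one_of_mem hz
    nlinarith
  refine ⟨-⌊s + k⌋, ?_⟩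
  set t := s - ⌊s + k⌋ with ht
  have ht0 : 0 ≤ t + k := by have := Int.floor_le (s + k); rw [ht]; linarith
  have ht1 : t + k < 1 := by have := Int.lt_floor_add_one (s + k); rw [ht]; linarith
  have hy' : y + ((-⌊s + k⌋ : ℤ) : ℝ) • p = k • v + t • p := by
    rw [eq_add_of_sub_eq hs, ht]
    push_cast
    module
  rw [hy']
  rcases le_or_gt 0 t with h | h
  · exact (hsub hk0.le h hv hp).trans_lt (by linarith)
  · have : k • v + t • p = (k + t) • v + (-t) • (v - p) := by module
    rw [this]
    exact (hsub (by linarith) (by linarith) hv hvp).trans_lt (by linarith)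

/-- If every boundary point of `K` is a vertex of an inscribed affinely regular hexagon whose
consecutive vertices have wedge product `c`, then every packing lattice has covolume
at least `4 * c`. -/
lemma four_mul_le_covolume {K : Set (ℝ × ℝ)} (hK : IsCSCD K) {c : ℝ}
    (hc : ∀ p ∈ frontier K, ∃ v ∈ K, v - p ∈ K ∧ wedge p v = c) {v w : ℝ × ℝ}
    (hvw : wedge v w ≠ 0) (hpack : IsPacking K (latticeOf v w)) : 4 * c ≤ |wedge v w| := by
  by_contra! hlt
  obtain ⟨l, hl, l', hl', hll, hmin⟩ := exists_basis_min_gauge hK hvw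
  have hD : 0 < |wedge v w| := abs_pos.2 hvw
  have hl0 : l ≠ 0 := wedge_ne_zero_left (w := l') (by rw [hll]; exact hD.ne')
  have hr : 2 ≤ gauge K l := by
    have := hpack.half_notMem hK (zero_mem_latticeOf v w) hl hl0
    rw [← gauge_lt_one_iff_mem_interior hK.1 hK.mem_nhds_zero, not_lt,
      gauge_smul_of_nonneg (by norm_num), smul_eq_mul] at this
    linarith
  set r := gauge K l with hrdef
  have hr0 : 0 < r := by linarith
  have hp : r⁻¹ • l ∈ frontier K := by
    rw [← gauge_eq_one_iff_mem_frontier hK.1 hK.mem_nhds_zero,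
      gauge_smul_of_nonneg (by positivity), smul_eq_mul, ← hrdef, inv_mul_cancel₀ hr0.ne']
  obtain ⟨u, hu, hup, huc⟩ := hc _ hp
  have hwy : wedge (r⁻¹ • l) (r⁻¹ • l') = |wedge v w| / r ^ 2 := by
    rw [wedge_smul_left, wedge_smul_right, hll]; field_simp
  obtain ⟨n, hn⟩ := exists_gauge_add_lt_one hK (hK.frontier_subset hp) hu hup
    (hK.ne_zero_of_mem_frontier hp) (y := r⁻¹ • l') (by rw [hwy]; positivity) (by
      rw [hwy, huc, div_lt_iff₀ (by positivity)]
      nlinarith [mul_self_nonneg (r - 2)])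
  have hz : r⁻¹ • l' + (n : ℝ) • r⁻¹ • l = r⁻¹ • (l' + (n : ℝ) • l) := by module
  rw [hz, gauge_smul_of_nonneg (by positivity), smul_eq_mul, inv_mul_lt_one₀ hr0] at hn
  refine hn.not_ge (hmin _ ?_ fun h => ?_)
  · obtain ⟨a, b, rfl⟩ := hl
    obtain ⟨a', b', rfl⟩ := hl'
    exact ⟨a' + n * a, b' + n * b, by push_cast; module⟩
  · have := congrArg (wedge l) h
    rw [wedge_add_right, wedge_smul_right, wedge_self, hll] at this
    have z2 : wedge l 0 = 0 := by simp [wedge]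
    rw [z2] at this
    linarith

/-- Let `K` be a centrally symmetric convex domain without corners such that each
boundary point `p` is a midpoint of a balanced hexagon `G p`, all of the same
area `A`.  Then `K` has no balanced hexagons other than the `G p`, and
`δ_lat(K) = area K / area G` for every balanced hexagon `G` of `K`. -/
theorem deltaLat_eq_of_balanced_hexagons (K : Set (ℝ × ℝ)) (hK : IsCSCD K)
    (hnc : NoCorners K) (G : ℝ × ℝ → ZMod 6 → ℝ × ℝ) (A : ℝ)
    (hG : ∀ p ∈ frontier K, IsBalancedHexagon K (G p) ∧
      (∃ j, midpoint ℝ (G p j) (G p (j + 1)) = p) ∧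
      (volume (convexHull ℝ (Set.range (G p)))).toReal = A) :
    (∀ w : ZMod 6 → ℝ × ℝ, IsBalancedHexagon K w →
      ∃ p ∈ frontier K, convexHull ℝ (Set.range w) = convexHull ℝ (Set.range (G p))) ∧
    (∀ w : ZMod 6 → ℝ × ℝ, IsBalancedHexagon K w →
      deltaLat K = (volume K).toReal / (volume (convexHull ℝ (Set.range w))).toReal) := by
  have based : ∀ p ∈ frontier K, ∃ w', IsBalancedHexagon K w' ∧ sideMid w' 0 = p ∧
      Set.range w' = Set.range (G p) ∧ 4 * wedge (sideMid w' 0) (sideMid w' 1) = A := by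
    intro p hp
    obtain ⟨hb, ⟨j, hj⟩, hA⟩ := hG p hp
    obtain ⟨hb', hr⟩ := hb.shift j
    refine ⟨_, hb', ?_, hr, ?_⟩
    · rw [sideMid, zero_add, zero_add, add_comm 1 j, hj]
    · rw [← hb'.volume_hull hK hnc, hr, hA]
  have hull : ∀ w : ZMod 6 → ℝ × ℝ, IsBalancedHexagon K w →
      ∃ p ∈ frontier K, convexHull ℝ (Set.range w) = convexHull ℝ (Set.range (G p)) := by
    intro w hw
    obtain ⟨w', hw', h0, hr, -⟩ := based _ (hw.sideMid_mem_frontier 0)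
    exact ⟨_, hw.sideMid_mem_frontier 0, hr ▸ hw.hull_eq hw' hK hnc h0.symm⟩
  refine ⟨hull, fun w hw => ?_⟩
  have hvol : (volume (convexHull ℝ (Set.range w))).toReal = A := by
    obtain ⟨p, hp, he⟩ := hull w hw
    rw [he, (hG p hp).2.2]
  have hwA := hw.volume_hull hK hnc
  rw [hvol] at hwA ⊢
  have hpos : 0 < wedge (sideMid w 0) (sideMid w 1) := by
    simpa using hw.wedge_sideMid_pos hK hnc 0
  have hcov : wedge ((2 : ℝ) • sideMid w 0) ((2 : ℝ) • sideMid w 1) = A := by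
    rw [wedge_smul_left, wedge_smul_right, hwA]; ring
  have hA : 0 < A := by linarith
  refine IsGreatest.csSup_eq ⟨⟨_, _, by rw [hcov]; exact hA.ne', hw.isPacking hK hnc,
    by rw [hcov, abs_of_pos hA]⟩, ?_⟩
  rintro _ ⟨v, v', hv, hpack, rfl⟩
  have hle := four_mul_le_covolume hK (c := A / 4) (fun p hp => by
    obtain ⟨w', hw', h0, -, h4⟩ := based p hp
    refine ⟨sideMid w' 1, hK.frontier_subset (hw'.sideMid_mem_frontier 1), ?_, ?_⟩
    · rw [← h0]; exact hK.frontier_subset hw'.sideMid_two_mem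
    · rw [← h0]; linarith) hv hpack
  rw [mul_div_cancel₀ A (by norm_num)] at hle
  exact div_le_div_of_nonneg_left ENNReal.toReal_nonneg hA hle
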